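/- For all δ,ε>0 there exist Δ₀=Δ₀(δ,ε) and C=C(δ,ε) such that for every finite graph G=(V,E) with maximum degree Δ≥Δ₀ and girth at least 6, and every 0<λ<(1−δ)·λ_c(Δ), the following holds: for every integer t≥C, every v∈V and every p∈N(v), the loopy belief propagation estimate satisfies |q^t(v,p)/μ(v is occupied | p is unoccupied) − 1| ≤ ε, where μ is the hard-core Gibbs distribution and the BP messages are started from any initial values R⁰_{v→p} ∈ [0,λ]. -/

import Mathlib

open scoped BigOperators

attribute [local instance] Classical.propDecidable

noncomputable section

namespace HardCore

/-- The critical fugacity `λ_c(Δ) = (Δ-1)^(Δ-1) / (Δ-2)^Δ`. -/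
def lambdaC (D : ℕ) : ℝ := ((D : ℝ) - 1) ^ (D - 1) / ((D : ℝ) - 2) ^ D

variable {V : Type} [Fintype V] [DecidableEq V]

/-- `s` is an independent set of `G`. -/
def IsIndep (G : SimpleGraph V) (s : Finset V) : Prop :=
  ∀ u ∈ s, ∀ w ∈ s, ¬ G.Adj u w

/-- One iteration of the loopy BP message updates:
`R'_{v→p} = λ · ∏_{w ∈ N(v)\{p}} 1/(1 + R_{w→v})`. -/
def bpIter (G : SimpleGraph V) [DecidableRel G.Adj] (lam : ℝ) (R : V → V → ℝ) :
    V → V → ℝ :=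
  fun v p => lam * ∏ w ∈ (G.neighborFinset v).erase p, (1 + R w v)⁻¹

/-- `μ(v is occupied | p is unoccupied)` under the hard-core Gibbs distribution. -/
def condOcc (G : SimpleGraph V) (lam : ℝ) (v p : V) : ℝ :=
  (∑ s : Finset V, if IsIndep G s ∧ v ∈ s ∧ p ∉ s then lam ^ s.card else 0) /
  (∑ s : Finset V, if IsIndep G s ∧ p ∉ s then lam ^ s.card else 0)

end HardCore

namespace HardCore

set_option linter.unusedSectionVars false

variable {V : Type} [Fintype V] [DecidableEq V]

/-- The unnormalised Gibbs weight of a vertex set. -/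
def weight (G : SimpleGraph V) (lam : ℝ) (s : Finset V) : ℝ :=
  if IsIndep G s then lam ^ s.card else 0

/-- The partition function. -/
def partitionFn (G : SimpleGraph V) (lam : ℝ) : ℝ := ∑ s : Finset V, weight G lam s

/-- Expectation under the hard-core Gibbs distribution. -/
def gibbsExp (G : SimpleGraph V) (lam : ℝ) (f : Finset V → ℝ) : ℝ :=
  (∑ s : Finset V, weight G lam s * f s) / partitionFn G lam

/-- The indicator that all vertices of `A` are unoccupied. -/
def vacant (A s : Finset V) : ℝ := if Disjoint A s then 1 else 0

/-- The number of neighbours `w ≠ p` of `v` all of whose neighbours other than `v` are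
unoccupied. -/
def unblocked (G : SimpleGraph V) [DecidableRel G.Adj] (v p : V) (s : Finset V) : ℝ :=
  ∑ w ∈ (G.neighborFinset v).erase p, vacant ((G.neighborFinset w).erase v) s

/-- The conditional probability that all neighbours of `v` other than `p` are unoccupied, given
the configuration `s` outside these neighbours, when `v ∉ s`. -/
def vacantProb (G : SimpleGraph V) [DecidableRel G.Adj] (lam : ℝ) (v p : V) (s : Finset V) : ℝ :=
  Real.exp (-(Real.log (1 + lam) * unblocked G v p s))

section Basic

variable {G : SimpleGraph V} {lam : ℝ}

lemma weight_nonneg (hl : 0 < lam) (s : Finset V) : 0 ≤ weight G lam s := by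
  unfold weight; split_ifs <;> positivity

lemma partitionFn_pos (hl : 0 < lam) : 0 < partitionFn G lam := by
  refine Finset.sum_pos' (fun s _ => weight_nonneg hl s) ⟨∅, Finset.mem_univ _, ?_⟩
  simp [weight, IsIndep]

lemma gibbsExp_mono (hl : 0 < lam) {f g : Finset V → ℝ} (h : ∀ s, f s ≤ g s) :
    gibbsExp G lam f ≤ gibbsExp G lam g :=
  div_le_div_of_nonneg_right
    (Finset.sum_le_sum fun s _ => mul_le_mul_of_nonneg_left (h s) (weight_nonneg hl s))
    (partitionFn_pos hl).le

lemma gibbsExp_const (hl : 0 < lam) (c : ℝ) : gibbsExp G lam (fun _ => c) = c := by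
  have := (partitionFn_pos (G := G) hl).ne'
  rw [gibbsExp, ← Finset.sum_mul]
  change partitionFn G lam * c / _ = c
  field_simp

lemma gibbsExp_add (f g : Finset V → ℝ) :
    gibbsExp G lam (fun s => f s + g s) = gibbsExp G lam f + gibbsExp G lam g := by
  simp only [gibbsExp, mul_add, Finset.sum_add_distrib, add_div]

lemma gibbsExp_sub (f g : Finset V → ℝ) :
    gibbsExp G lam (fun s => f s - g s) = gibbsExp G lam f - gibbsExp G lam g := by
  simp only [gibbsExp, mul_sub, Finset.sum_sub_distrib, sub_div]

lemma gibbsExp_const_mul (c : ℝ) (f : Finset V → ℝ) :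
    gibbsExp G lam (fun s => c * f s) = c * gibbsExp G lam f := by
  simp only [gibbsExp, mul_div_assoc', Finset.mul_sum]
  congr 1
  exact Finset.sum_congr rfl fun s _ => by ring

lemma gibbsExp_sum {ι : Type*} (T : Finset ι) (f : ι → Finset V → ℝ) :
    gibbsExp G lam (fun s => ∑ i ∈ T, f i s) = ∑ i ∈ T, gibbsExp G lam (f i) := by
  simp only [gibbsExp, Finset.mul_sum, ← Finset.sum_div]
  rw [Finset.sum_comm]

lemma abs_gibbsExp_le (hl : 0 < lam) {f g : Finset V → ℝ} (h : ∀ s, |f s| ≤ g s) :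
    |gibbsExp G lam f| ≤ gibbsExp G lam g := by
  rw [abs_le]
  constructor
  · have := gibbsExp_mono (G := G) hl (f := fun s => (-1) * g s) (g := f)
      (fun s => by linarith [(abs_le.1 (h s)).1])
    rw [gibbsExp_const_mul] at this
    linarith
  · exact gibbsExp_mono hl fun s => (abs_le.1 (h s)).2

lemma vacant_nonneg (A s : Finset V) : 0 ≤ vacant A s := by
  unfold vacant; split_ifs <;> norm_num

lemma vacant_le_one (A s : Finset V) : vacant A s ≤ 1 := by
  unfold vacant; split_ifs <;> norm_num

lemma vacant_sdiff {A B : Finset V} (h : Disjoint A B) (s : Finset V) :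
    vacant A (s \ B) = vacant A s := by
  have : Disjoint A (s \ B) ↔ Disjoint A s := by
    refine ⟨fun h' => ?_, fun h' => h'.mono_right Finset.sdiff_subset⟩
    rw [Finset.disjoint_left] at *
    intro a ha has
    exact h' ha (Finset.mem_sdiff.2 ⟨has, h ha⟩)
  simp [vacant, this]

lemma sum_eq_sum_sdiff_inter (A : Finset V) (h : Finset V → ℝ) :
    ∑ s, h s = ∑ τ ∈ (Aᶜ).powerset, ∑ B ∈ A.powerset, h (τ ∪ B) := by
  rw [← Finset.sum_product']
  refine Finset.sum_nbij' (fun s => (s \ A, s ∩ A)) (fun x => x.1 ∪ x.2) ?_ ?_ ?_ ?_ ?_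
  · intro s _
    simp only [Finset.mem_product, Finset.mem_powerset]
    exact ⟨fun x hx => by simp at hx ⊢; exact hx.2, Finset.inter_subset_right⟩
  · simp
  · intro s _; exact Finset.sdiff_union_inter s A
  · rintro ⟨τ, B⟩ hx
    simp only [Finset.mem_product, Finset.mem_powerset] at hx
    have h1 : ∀ x ∈ τ, x ∉ A := fun x hx' => by simpa using hx.1 hx'
    ext x
    · simp only [Finset.mem_sdiff, Finset.mem_union]
      have := h1 x; have := @hx.2 x; tauto
    · simp only [Finset.mem_inter, Finset.mem_union]
      have := h1 x; have := @hx.2 x; tauto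
  · intro s _; simp only [Finset.sdiff_union_inter]

end Basic

section Resampling

variable {G : SimpleGraph V} [DecidableRel G.Adj] {lam : ℝ}

lemma exp_neg_log_mul_sum_vacant (hl : 0 < lam) (A s : Finset V) :
    Real.exp (-(Real.log (1 + lam) * ∑ z ∈ A, vacant (G.neighborFinset z) s)) =
      ((1 + lam) ^ (A.filter fun z => Disjoint (G.neighborFinset z) s).card)⁻¹ := by
  have : ∑ z ∈ A, vacant (G.neighborFinset z) s =
      ((A.filter fun z => Disjoint (G.neighborFinset z) s).card : ℝ) := by
    simp only [vacant]
    rw [Finset.sum_boole]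
  rw [this, Real.exp_neg, mul_comm, Real.exp_nat_mul, Real.exp_log (by linarith)]

/-- Given the configuration outside an independent set `A`, the vertices of `A` that have no
occupied neighbour are occupied independently with probability `λ / (1 + λ)`. -/
lemma gibbsExp_vacant_mul (hl : 0 < lam) {A : Finset V}
    (hA : ∀ z ∈ A, Disjoint (G.neighborFinset z) A) {g : Finset V → ℝ}
    (hg : ∀ s, g (s \ A) = g s) :
    gibbsExp G lam (fun s => (vacant A s -
      Real.exp (-(Real.log (1 + lam) * ∑ z ∈ A, vacant (G.neighborFinset z) s))) * g s) = 0 := by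
  rw [gibbsExp, sum_eq_sum_sdiff_inter A, div_eq_zero_iff]
  left
  refine Finset.sum_eq_zero fun τ hτ => ?_
  have hτA : ∀ x ∈ τ, x ∉ A := fun x hx => by simpa using (Finset.mem_powerset.1 hτ) hx
  have hsd : ∀ B ∈ A.powerset, (τ ∪ B) \ A = τ := by
    intro B hB
    ext x
    simp only [Finset.mem_sdiff, Finset.mem_union]
    have h1 := hτA x
    have h2 : x ∈ B → x ∈ A := fun hx => Finset.mem_powerset.1 hB hx
    tauto
  by_cases hind : IsIndep G τ
  swap
  · refine Finset.sum_eq_zero fun B _ => ?_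
    have : ¬ IsIndep G (τ ∪ B) := fun h => hind fun u hu w hw =>
      h u (Finset.mem_union_left _ hu) w (Finset.mem_union_left _ hw)
    simp [weight, this]
  set A' := A.filter fun z => Disjoint (G.neighborFinset z) τ with hA'
  have hterm : ∀ B ∈ A.powerset, weight G lam (τ ∪ B) * ((vacant A (τ ∪ B) -
      Real.exp (-(Real.log (1 + lam) * ∑ z ∈ A, vacant (G.neighborFinset z) (τ ∪ B)))) *
        g (τ ∪ B)) =
      (lam ^ τ.card * g τ) * (if B ⊆ A' then lam ^ B.card *
        ((if B = ∅ then 1 else 0) - ((1 + lam) ^ A'.card)⁻¹) else 0) := by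
    intro B hB
    have hBA := Finset.mem_powerset.1 hB
    have h1 : g (τ ∪ B) = g τ := by rw [← hg, hsd B hB]
    have h2 : ∑ z ∈ A, vacant (G.neighborFinset z) (τ ∪ B) =
        ∑ z ∈ A, vacant (G.neighborFinset z) τ :=
      Finset.sum_congr rfl fun z hz => by rw [← vacant_sdiff (hA z hz), hsd B hB]
    have h3 : vacant A (τ ∪ B) = if B = ∅ then 1 else 0 := by
      have : Disjoint A (τ ∪ B) ↔ B = ∅ := by
        constructor
        · intro h
          rw [Finset.eq_empty_iff_forall_notMem]
          exact fun x hx => Finset.disjoint_left.1 h (hBA hx) (Finset.mem_union_right _ hx)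
        · rintro rfl
          rw [Finset.disjoint_left]
          intro x hx hx'
          exact hτA x (by simpa using hx') hx
      simp [vacant, this]
    have h4 : IsIndep G (τ ∪ B) ↔ B ⊆ A' := by
      constructor
      · intro h z hz
        rw [hA', Finset.mem_filter, Finset.disjoint_left]
        refine ⟨hBA hz, fun x hx hxt => ?_⟩
        exact h z (Finset.mem_union_right _ hz) x (Finset.mem_union_left _ hxt)
          ((G.mem_neighborFinset _ _).1 hx)
      · intro h u hu w hw huw
        have key : ∀ z ∈ B, ∀ x ∈ τ, ¬ G.Adj z x := fun z hz x hx hzx =>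
          Finset.disjoint_left.1 (Finset.mem_filter.1 (h hz)).2
            ((G.mem_neighborFinset _ _).2 hzx) hx
        rcases Finset.mem_union.1 hu with hu | hu <;> rcases Finset.mem_union.1 hw with hw | hw
        · exact hind u hu w hw huw
        · exact key w hw u hu huw.symm
        · exact key u hu w hw huw
        · exact Finset.disjoint_left.1 (hA u (hBA hu)) ((G.mem_neighborFinset _ _).2 huw) (hBA hw)
    have h5 : (τ ∪ B).card = τ.card + B.card :=
      Finset.card_union_of_disjoint (Finset.disjoint_left.2 fun x hx hxB => hτA x hx (hBA hxB))
    rw [h1, h2, h3, exp_neg_log_mul_sum_vacant hl, weight, h5, pow_add]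
    simp only [h4]
    split_ifs <;> ring
  rw [Finset.sum_congr rfl hterm, ← Finset.mul_sum]
  have hA'A : A' ⊆ A := Finset.filter_subset _ _
  have : ∑ B ∈ A.powerset, (if B ⊆ A' then lam ^ B.card *
        ((if B = ∅ then 1 else 0) - ((1 + lam) ^ A'.card)⁻¹) else 0) =
      ∑ B ∈ A'.powerset, lam ^ B.card *
        ((if B = ∅ then 1 else 0) - ((1 + lam) ^ A'.card)⁻¹) := by
    rw [← Finset.sum_filter]
    refine Finset.sum_congr ?_ fun _ _ => rfl
    ext B
    simp only [Finset.mem_filter, Finset.mem_powerset]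
    exact ⟨fun h => h.2, fun h => ⟨h.trans hA'A, h⟩⟩
  rw [this]
  have hsum : ∑ B ∈ A'.powerset, lam ^ B.card = (1 + lam) ^ A'.card := by
    have := Finset.sum_pow_mul_eq_add_pow lam 1 A'
    simp only [one_pow, mul_one] at this
    rw [this, add_comm]
  have hpos : (0 : ℝ) < (1 + lam) ^ A'.card := by positivity
  simp only [mul_sub, Finset.sum_sub_distrib, ← Finset.sum_mul, hsum]
  simp only [mul_ite, mul_one, mul_zero]
  rw [Finset.sum_ite_eq' A'.powerset ∅]
  simp [hpos.ne']

/-- A vertex is occupied with probability `λ / (1 + λ)` times the probability that its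
neighbourhood is vacant. -/
lemma gibbsExp_occupied (hl : 0 < lam) (v : V) :
    gibbsExp G lam (fun s => 1 - vacant {v} s) =
      lam / (1 + lam) * gibbsExp G lam (vacant (G.neighborFinset v)) := by
  have h := gibbsExp_vacant_mul (G := G) hl (A := {v}) (g := fun _ => 1)
    (by simp) (fun _ => rfl)
  rw [← gibbsExp_const_mul]
  have h2 : gibbsExp G lam (fun s => (1 - vacant {v} s) -
      lam / (1 + lam) * vacant (G.neighborFinset v) s) = 0 := by
    rw [← neg_eq_zero, ← neg_one_mul, ← gibbsExp_const_mul, ← h]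
    congr 1
    ext s
    rw [exp_neg_log_mul_sum_vacant hl]
    simp only [Finset.filter_singleton, vacant]
    by_cases hd : Disjoint (G.neighborFinset v) s
    · simp only [hd, if_true, Finset.card_singleton]
      field_simp
      ring
    · simp [hd]
  rw [gibbsExp_sub] at h2
  linarith

lemma gibbsExp_occupied_nonneg (hl : 0 < lam) (v : V) :
    0 ≤ gibbsExp G lam (fun s => 1 - vacant {v} s) := by
  have := gibbsExp_mono (G := G) hl (f := fun _ => 0) (g := fun s => 1 - vacant {v} s)
    (fun s => by linarith [vacant_le_one {v} s])
  rwa [gibbsExp_const hl] at this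

lemma gibbsExp_occupied_le (hl : 0 < lam) (v : V) :
    gibbsExp G lam (fun s => 1 - vacant {v} s) ≤ lam := by
  rw [gibbsExp_occupied hl]
  have h1 : gibbsExp G lam (vacant (G.neighborFinset v)) ≤ 1 := by
    have := gibbsExp_mono (G := G) hl (vacant_le_one (G.neighborFinset v))
    rwa [gibbsExp_const hl] at this
  have h2 : lam / (1 + lam) ≤ lam := div_le_self hl.le (by linarith)
  calc _ ≤ lam / (1 + lam) * 1 := by gcongr
    _ ≤ lam := by linarith

end Resampling

end HardCore

namespace HardCore

section Girth

variable {V : Type} {G : SimpleGraph V}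

open SimpleGraph.Walk in
lemma not_triangle (hG : 6 ≤ G.egirth) {a b c : V} (h1 : G.Adj a b) (h2 : G.Adj b c)
    (h3 : G.Adj c a) : False := by
  have hc : (cons h1 (cons h2 (cons h3 nil))).IsCycle := by
    have := h1.ne; have := h2.ne; have := h3.ne
    have := h1.ne'; have := h2.ne'; have := h3.ne'
    simp [cons_isCycle_iff, cons_isPath_iff, *]
  have := SimpleGraph.le_egirth.1 hG _ _ hc
  simp only [length_cons, length_nil] at this
  norm_num at this

open SimpleGraph.Walk in
lemma not_fourCycle (hG : 6 ≤ G.egirth) {a b c d : V} (h1 : G.Adj a b) (h2 : G.Adj b c)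
    (h3 : G.Adj c d) (h4 : G.Adj d a) (hac : a ≠ c) (hbd : b ≠ d) : False := by
  have hc : (cons h1 (cons h2 (cons h3 (cons h4 nil)))).IsCycle := by
    have := h1.ne; have := h2.ne; have := h3.ne; have := h4.ne
    have := h1.ne'; have := h2.ne'; have := h3.ne'; have := h4.ne'
    have := hac.symm; have := hbd.symm
    simp [cons_isCycle_iff, cons_isPath_iff, *]
  have := SimpleGraph.le_egirth.1 hG _ _ hc
  simp only [length_cons, length_nil] at this
  norm_num at this

open SimpleGraph.Walk in
lemma not_closed_five (hG : 6 ≤ G.egirth) {a b c d e : V} (h1 : G.Adj a b) (h2 : G.Adj b c)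
    (h3 : G.Adj c d) (h4 : G.Adj d e) (h5 : G.Adj e a) : False := by
  have hac : a ≠ c := by rintro rfl; exact not_triangle hG h3 h4 h5
  have hbd : b ≠ d := by rintro rfl; exact not_triangle hG h4 h5 h1
  have hce : c ≠ e := by rintro rfl; exact not_triangle hG h5 h1 h2
  have hda : d ≠ a := by rintro rfl; exact not_triangle hG h1 h2 h3
  have heb : e ≠ b := by rintro rfl; exact not_triangle hG h2 h3 h4
  have hc : (cons h1 (cons h2 (cons h3 (cons h4 (cons h5 nil))))).IsCycle := by
    have := h1.ne; have := h2.ne; have := h3.ne; have := h4.ne; have := h5.ne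
    have := h1.ne'; have := h2.ne'; have := h3.ne'; have := h4.ne'; have := h5.ne'
    have := hac.symm; have := hbd.symm; have := hce.symm; have := hda.symm; have := heb.symm
    simp [cons_isCycle_iff, cons_isPath_iff, *]
  have := SimpleGraph.le_egirth.1 hG _ _ hc
  simp only [length_cons, length_nil] at this
  norm_num at this

end Girth

section Decorrelation

variable {V : Type} [Fintype V] [DecidableEq V] {G : SimpleGraph V} [DecidableRel G.Adj]
  {lam : ℝ}

lemma unblocked_nonneg (v p : V) (s : Finset V) : 0 ≤ unblocked G v p s :=
  Finset.sum_nonneg fun _ _ => vacant_nonneg _ _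

lemma vacantProb_pos (v p : V) (s : Finset V) : 0 < vacantProb G lam v p s := Real.exp_pos _

lemma vacantProb_le_one (hl : 0 < lam) (v p : V) (s : Finset V) :
    vacantProb G lam v p s ≤ 1 := by
  refine Real.exp_le_one_iff.2 (neg_nonpos.2 (mul_nonneg ?_ (unblocked_nonneg v p s)))
  exact Real.log_nonneg (by linarith)

lemma vacantProb_sdiff {A : Finset V} {w v : V}
    (h : ∀ z ∈ (G.neighborFinset w).erase v, Disjoint ((G.neighborFinset z).erase w) A)
    (s : Finset V) : vacantProb G lam w v (s \ A) = vacantProb G lam w v s := by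
  unfold vacantProb unblocked
  rw [Finset.sum_congr rfl fun z hz => vacant_sdiff (h z hz) s]

/-- The deviation of the vacancy of a neighbourhood from its conditional probability. -/
def vacantDev (G : SimpleGraph V) [DecidableRel G.Adj] (lam : ℝ) (w v : V) (s : Finset V) : ℝ :=
  vacant ((G.neighborFinset w).erase v) s - vacantProb G lam w v s

lemma abs_vacantDev_le_one (hl : 0 < lam) (w v : V) (s : Finset V) :
    |vacantDev G lam w v s| ≤ 1 := by
  have h1 := vacant_nonneg ((G.neighborFinset w).erase v) s
  have h2 := vacant_le_one ((G.neighborFinset w).erase v) s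
  have h3 := vacantProb_pos (G := G) (lam := lam) w v s
  have h4 := vacantProb_le_one (G := G) hl w v s
  rw [abs_le, vacantDev]
  constructor <;> linarith

lemma abs_gibbsExp_vacantDev_mul_le (hG : 6 ≤ G.egirth) (hl : 0 < lam) (w v : V)
    {f : Finset V → ℝ} (hf1 : ∀ s, |f s| ≤ 1)
    (hf : ∀ s, f (s \ (G.neighborFinset w).erase v) = f s) :
    |gibbsExp G lam (fun s => vacantDev G lam w v s * f s)| ≤ lam := by
  set A := (G.neighborFinset w).erase v with hA
  have hAmem : ∀ z ∈ A, G.Adj w z := fun z hz =>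
    (G.mem_neighborFinset _ _).1 (Finset.mem_of_mem_erase hz)
  have h0 := gibbsExp_vacant_mul (G := G) hl (A := A) (g := fun s => vacant {w} s * f s)
    (by
      intro z hz
      rw [Finset.disjoint_left]
      intro x hx hxA
      exact not_triangle hG (hAmem z hz) ((G.mem_neighborFinset _ _).1 hx) (hAmem x hxA).symm)
    (by
      intro s
      have : Disjoint {w} A := by
        rw [Finset.disjoint_singleton_left]
        exact fun h => (hAmem w h).ne rfl
      simp only [hf, vacant_sdiff this])
  have h1 : gibbsExp G lam (fun s => vacantDev G lam w v s * f s) =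
      gibbsExp G lam (fun s => (1 - vacant {w} s) * (vacantDev G lam w v s * f s)) := by
    rw [← sub_eq_zero, ← gibbsExp_sub, ← h0]
    congr 1
    ext s
    by_cases hw : w ∈ s
    · simp [vacant, hw]
    · have : ∀ z ∈ A, vacant (G.neighborFinset z) s =
          vacant ((G.neighborFinset z).erase w) s := by
        intro z _
        have : Disjoint (G.neighborFinset z) s ↔ Disjoint ((G.neighborFinset z).erase w) s := by
          refine ⟨fun h => h.mono_left (Finset.erase_subset _ _), fun h => ?_⟩
          rw [Finset.disjoint_left] at *
          intro x hx hxs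
          exact h (Finset.mem_erase.2 ⟨fun e => hw (e ▸ hxs), hx⟩) hxs
        simp [vacant, this]
      have hw1 : vacant {w} s = 1 := by simp [vacant, hw]
      rw [Finset.sum_congr rfl this, hw1, vacantDev, vacantProb, unblocked]
      ring
  rw [h1]
  refine (abs_gibbsExp_le hl fun s => ?_).trans (gibbsExp_occupied_le (G := G) hl w)
  have hv : 0 ≤ 1 - vacant {w} s := by linarith [vacant_le_one {w} s]
  rw [abs_mul, abs_mul, abs_of_nonneg hv]
  have := mul_le_one₀ (abs_vacantDev_le_one (G := G) hl w v s) (abs_nonneg _) (hf1 s)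
  exact mul_le_of_le_one_right hv this

lemma abs_gibbsExp_vacantDev_mul_vacantDev_le (hG : 6 ≤ G.egirth) (hl : 0 < lam) {v w w' : V}
    (hw : G.Adj v w) (hw' : G.Adj v w') (hne : w ≠ w') :
    |gibbsExp G lam (fun s => vacantDev G lam w v s * vacantDev G lam w' v s)| ≤ lam := by
  refine abs_gibbsExp_vacantDev_mul_le hG hl w v (abs_vacantDev_le_one hl w' v) fun s => ?_
  rw [vacantDev, vacantDev, vacantProb_sdiff, vacant_sdiff]
  · rw [Finset.disjoint_left]
    intro z hz hz'
    simp only [Finset.mem_erase, SimpleGraph.mem_neighborFinset] at hz hz'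
    exact not_fourCycle hG hw hz'.2 hz.2.symm hw'.symm hz.1.symm hne
  · intro z hz
    rw [Finset.disjoint_left]
    intro x hx hx'
    simp only [Finset.mem_erase, SimpleGraph.mem_neighborFinset] at hx hx' hz
    exact not_closed_five hG hw hx'.2 hx.2.symm hz.2.symm hw'.symm

lemma gibbsExp_sq_sum_vacantDev_le (hG : 6 ≤ G.egirth) (hl : 0 < lam) (v p : V) :
    gibbsExp G lam (fun s => (∑ w ∈ (G.neighborFinset v).erase p, vacantDev G lam w v s) ^ 2) ≤
      G.degree v + (G.degree v : ℝ) ^ 2 * lam := by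
  set T := (G.neighborFinset v).erase p with hT
  have hTadj : ∀ w ∈ T, G.Adj v w := fun w hw =>
    (G.mem_neighborFinset _ _).1 (Finset.mem_of_mem_erase hw)
  have hcard : (T.card : ℝ) ≤ G.degree v := by
    rw [← G.card_neighborFinset_eq_degree]
    exact_mod_cast Finset.card_le_card (Finset.erase_subset _ _)
  have h1 : ∀ w ∈ T, ∀ w' ∈ T,
      gibbsExp G lam (fun s => vacantDev G lam w v s * vacantDev G lam w' v s) ≤
        (if w = w' then 1 else 0) + lam := by
    intro w hw w' hw'
    split_ifs with h
    · subst h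
      have := gibbsExp_mono (G := G) hl
        (f := fun s => vacantDev G lam w v s * vacantDev G lam w v s) (g := fun _ => 1)
        (fun s => by
          rw [← abs_mul_abs_self]
          exact mul_le_one₀ (abs_vacantDev_le_one hl w v s) (abs_nonneg _)
            (abs_vacantDev_le_one hl w v s))
      rw [gibbsExp_const hl] at this
      linarith
    · have := abs_gibbsExp_vacantDev_mul_vacantDev_le hG hl (hTadj w hw) (hTadj w' hw') h
      linarith [(abs_le.1 this).2]
  simp only [sq, Finset.sum_mul_sum]
  rw [gibbsExp_sum]
  simp only [gibbsExp_sum]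
  calc _ ≤ ∑ w ∈ T, ∑ w' ∈ T, ((if w = w' then (1 : ℝ) else 0) + lam) :=
        Finset.sum_le_sum fun w hw => Finset.sum_le_sum fun w' hw' => h1 w hw w' hw'
    _ = T.card + T.card * T.card * lam := by
        simp only [Finset.sum_add_distrib, Finset.sum_ite_eq, Finset.sum_const, nsmul_eq_mul]
        rw [Finset.sum_congr rfl fun x hx => if_pos hx]
        simp
        ring
    _ ≤ _ := by gcongr

end Decorrelation

section Contraction

lemma sq_exp_neg_sq_sub_le {a : ℝ} (ha : 0 ≤ a) (x y : ℝ) :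
    (Real.exp (-(a * x ^ 2 / 2)) - Real.exp (-(a * y ^ 2 / 2))) ^ 2 ≤
      a * Real.exp (-1) * (x - y) ^ 2 := by
  have hder : ∀ r : ℝ, HasDerivAt (fun r : ℝ => Real.exp (-(a * r ^ 2 / 2)))
      (Real.exp (-(a * r ^ 2 / 2)) * (-(a * r))) r := by
    intro r
    have h1 : HasDerivAt (fun r : ℝ => -(a * r ^ 2 / 2)) (-(a * r)) r := by
      have := (((hasDerivAt_pow 2 r).const_mul a).div_const 2).neg
      exact this.congr_deriv (by push_cast; ring)
    exact h1.exp
  have hbd : ∀ r : ℝ, ‖Real.exp (-(a * r ^ 2 / 2)) * (-(a * r))‖ ≤ √(a * Real.exp (-1)) := by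
    intro r
    rw [Real.norm_eq_abs]
    refine Real.abs_le_sqrt ?_
    have h1 : Real.exp (-(a * r ^ 2 / 2)) ^ 2 = Real.exp (-(a * r ^ 2)) := by
      rw [← Real.exp_nat_mul]; congr 1; push_cast; ring
    have h2 : (a * r ^ 2) * Real.exp (-(a * r ^ 2)) ≤ Real.exp (-1) := by
      have h3 : a * r ^ 2 ≤ Real.exp (a * r ^ 2 - 1) := by
        linarith [Real.add_one_le_exp (a * r ^ 2 - 1)]
      calc _ ≤ Real.exp (a * r ^ 2 - 1) * Real.exp (-(a * r ^ 2)) := by gcongr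
        _ = _ := by rw [← Real.exp_add]; congr 1; ring
    calc _ = a * ((a * r ^ 2) * Real.exp (-(a * r ^ 2))) := by rw [mul_pow, h1]; ring
      _ ≤ _ := by gcongr
  have := convex_univ.norm_image_sub_le_of_norm_hasDerivWithin_le
    (f := fun r : ℝ => Real.exp (-(a * r ^ 2 / 2)))
    (fun r _ => (hder r).hasDerivWithinAt) (fun r _ => hbd r) (Set.mem_univ y) (Set.mem_univ x)
  rw [Real.norm_eq_abs, Real.norm_eq_abs] at this
  calc _ = |Real.exp (-(a * x ^ 2 / 2)) - Real.exp (-(a * y ^ 2 / 2))| ^ 2 := (sq_abs _).symm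
    _ ≤ (√(a * Real.exp (-1)) * |x - y|) ^ 2 := by gcongr
    _ = _ := by rw [mul_pow, sq_abs, Real.sq_sqrt (by positivity)]

lemma sq_exp_neg_sum_sub_le {ι : Type*} {a : ℝ} (ha : 0 ≤ a) (T : Finset ι) (x y : ι → ℝ)
    (hx : ∀ i, 0 ≤ x i) (hy : ∀ i, 0 ≤ y i) :
    (Real.exp (-(a * (∑ i ∈ T, x i) / 2)) - Real.exp (-(a * (∑ i ∈ T, y i) / 2))) ^ 2 ≤
      a * Real.exp (-1) * ∑ i ∈ T, (√(x i) - √(y i)) ^ 2 := by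
  have hX : 0 ≤ ∑ i ∈ T, x i := Finset.sum_nonneg fun i _ => hx i
  have hY : 0 ≤ ∑ i ∈ T, y i := Finset.sum_nonneg fun i _ => hy i
  have h := sq_exp_neg_sq_sub_le ha (√(∑ i ∈ T, x i)) (√(∑ i ∈ T, y i))
  rw [Real.sq_sqrt hX, Real.sq_sqrt hY] at h
  refine h.trans ?_
  gcongr
  have hcs := Real.sum_sqrt_mul_sqrt_le T hx hy
  rw [sub_sq, Real.sq_sqrt hX, Real.sq_sqrt hY]
  have : ∑ i ∈ T, (√(x i) - √(y i)) ^ 2 =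
      ∑ i ∈ T, x i - 2 * ∑ i ∈ T, √(x i) * √(y i) + ∑ i ∈ T, y i := by
    rw [Finset.mul_sum, ← Finset.sum_sub_distrib, ← Finset.sum_add_distrib]
    refine Finset.sum_congr rfl fun i _ => ?_
    rw [sub_sq, Real.sq_sqrt (hx i), Real.sq_sqrt (hy i)]; ring
  rw [this]
  linarith

lemma abs_exp_neg_sub_le {x y : ℝ} (hx : 0 ≤ x) (hy : 0 ≤ y) :
    |Real.exp (-x) - Real.exp (-y)| ≤ |x - y| := by
  wlog h : x ≤ y generalizing x y
  · rw [abs_sub_comm, abs_sub_comm x]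
    exact this hy hx (le_of_not_ge h)
  rw [abs_of_nonneg (sub_nonneg.2 (Real.exp_le_exp.2 (by linarith))), abs_sub_comm,
    abs_of_nonneg (sub_nonneg.2 h)]
  have h1 : Real.exp (-y) = Real.exp (-x) * Real.exp (x - y) := by
    rw [← Real.exp_add]; congr 1; ring
  have h2 := Real.add_one_le_exp (x - y)
  have h3 : Real.exp (-x) ≤ 1 := Real.exp_le_one_iff.2 (by linarith)
  have h4 := Real.exp_pos (-x)
  rw [h1]
  nlinarith

lemma add_sq_le {η : ℝ} (hη : 0 < η) (x y z : ℝ) :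
    (x + y + z) ^ 2 ≤ (1 + η) * x ^ 2 + (1 + 1 / η) * (2 * (y ^ 2 + z ^ 2)) := by
  have h1 : 0 ≤ (η * x - (y + z)) ^ 2 / η := by positivity
  have h2 : 0 ≤ (1 + 1 / η) * (y - z) ^ 2 := by positivity
  have h3 : (η * x - (y + z)) ^ 2 / η = η * x ^ 2 - 2 * x * (y + z) + 1 / η * (y + z) ^ 2 := by
    field_simp; ring
  rw [h3] at h1
  nlinarith

lemma log_one_add_le {x : ℝ} (hx : 0 ≤ x) : Real.log (1 + x) ≤ x := by
  linarith [Real.log_le_sub_one_of_pos (show 0 < 1 + x by linarith)]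

lemma sub_sq_le_log_one_add {x : ℝ} (hx : 0 ≤ x) : x - x ^ 2 ≤ Real.log (1 + x) := by
  have h := Real.one_sub_inv_le_log_of_pos (show 0 < 1 + x by linarith)
  have : x - x ^ 2 ≤ 1 - (1 + x)⁻¹ := by
    have h1 : 0 < 1 + x := by linarith
    rw [← sub_nonneg]
    have : 1 - (1 + x)⁻¹ - (x - x ^ 2) = x ^ 3 / (1 + x) := by field_simp; ring
    rw [this]; positivity
  linarith

/-- `log (1 + λ F)` is close to `F log (1 + λ)`. -/
lemma abs_mul_log_sub_log_le {lam F : ℝ} (hl : 0 < lam) (h0 : 0 ≤ F) (h1 : F ≤ 1) :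
    |Real.log (1 + lam) * F - Real.log (1 + lam * F)| ≤ lam ^ 2 := by
  have ha := log_one_add_le hl.le
  have hb := sub_sq_le_log_one_add hl.le
  have hc := log_one_add_le (mul_nonneg hl.le h0)
  have hd := sub_sq_le_log_one_add (mul_nonneg hl.le h0)
  have hF2 : (lam * F) ^ 2 ≤ lam ^ 2 := by
    rw [mul_pow]
    exact mul_le_of_le_one_right (sq_nonneg _) (pow_le_one₀ h0 h1)
  have h3 : lam ^ 2 * F ≤ lam ^ 2 := mul_le_of_le_one_right (sq_nonneg _) h1
  have h4 := mul_le_mul_of_nonneg_right ha h0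
  have h5 := mul_le_mul_of_nonneg_right hb h0
  rw [abs_le]
  constructor <;> nlinarith

lemma sq_sqrt_exp_sub_sqrt_prod_le {ι : Type*} {lam η : ℝ} (hl : 0 < lam) (hη : 0 < η)
    (T : Finset ι) (u Y F : ι → ℝ) (hu : ∀ i, 0 ≤ u i) (hY : ∀ i, 0 ≤ Y i)
    (hF0 : ∀ i, 0 ≤ F i) (hF1 : ∀ i, F i ≤ 1) :
    (√(Real.exp (-(Real.log (1 + lam) * ∑ i ∈ T, u i))) - √(∏ i ∈ T, (1 + lam * F i)⁻¹)) ^ 2 ≤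
      (1 + η) * (lam * Real.exp (-1) * ∑ i ∈ T, (√(Y i) - √(F i)) ^ 2) +
      (1 + 1 / η) * (2 * (lam ^ 2 * (∑ i ∈ T, (u i - Y i)) ^ 2 + (T.card * lam ^ 2) ^ 2)) := by
  set a := Real.log (1 + lam) with ha
  have ha0 : 0 ≤ a := Real.log_nonneg (by linarith)
  have hal : a ≤ lam := log_one_add_le hl.le
  have hpos : ∀ i, 0 < 1 + lam * F i := fun i => by have := mul_nonneg hl.le (hF0 i); linarith
  have hprod : ∏ i ∈ T, (1 + lam * F i)⁻¹ = Real.exp (-(∑ i ∈ T, Real.log (1 + lam * F i))) := by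
    rw [← Finset.sum_neg_distrib, Real.exp_sum]
    exact Finset.prod_congr rfl fun i _ => by rw [Real.exp_neg, Real.exp_log (hpos i)]
  have hlog0 : ∀ i, 0 ≤ Real.log (1 + lam * F i) := fun i =>
    Real.log_nonneg (by have := mul_nonneg hl.le (hF0 i); linarith)
  rw [hprod, ← Real.exp_half, ← Real.exp_half, neg_div, neg_div]
  set p := Real.exp (-(a * (∑ i ∈ T, u i) / 2)) with hp
  set q := Real.exp (-(a * (∑ i ∈ T, Y i) / 2)) with hq
  set r := Real.exp (-(a * (∑ i ∈ T, F i) / 2)) with hr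
  set t := Real.exp (-((∑ i ∈ T, Real.log (1 + lam * F i)) / 2)) with ht
  have hSu : 0 ≤ ∑ i ∈ T, u i := Finset.sum_nonneg fun i _ => hu i
  have hSY : 0 ≤ ∑ i ∈ T, Y i := Finset.sum_nonneg fun i _ => hY i
  have hSF : 0 ≤ ∑ i ∈ T, F i := Finset.sum_nonneg fun i _ => hF0 i
  have hSl : 0 ≤ ∑ i ∈ T, Real.log (1 + lam * F i) := Finset.sum_nonneg fun i _ => hlog0 i
  have h1 : (q - r) ^ 2 ≤ lam * Real.exp (-1) * ∑ i ∈ T, (√(Y i) - √(F i)) ^ 2 := by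
    refine (sq_exp_neg_sum_sub_le ha0 T Y F hY hF0).trans ?_
    have : 0 ≤ ∑ i ∈ T, (√(Y i) - √(F i)) ^ 2 := Finset.sum_nonneg fun i _ => sq_nonneg _
    gcongr
  have h2 : (p - q) ^ 2 ≤ lam ^ 2 * (∑ i ∈ T, (u i - Y i)) ^ 2 := by
    have h := abs_exp_neg_sub_le (x := a * (∑ i ∈ T, u i) / 2) (y := a * (∑ i ∈ T, Y i) / 2)
      (by positivity) (by positivity)
    have h' := sq_le_sq.2 h
    refine h'.trans ?_
    rw [Finset.sum_sub_distrib]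
    have e : (a * (∑ i ∈ T, u i) / 2 - a * (∑ i ∈ T, Y i) / 2) ^ 2 =
      (a / 2) ^ 2 * (∑ i ∈ T, u i - ∑ i ∈ T, Y i) ^ 2 := by ring
    rw [e]
    gcongr
    linarith
  have h3 : (r - t) ^ 2 ≤ (T.card * lam ^ 2) ^ 2 := by
    have h := abs_exp_neg_sub_le (x := a * (∑ i ∈ T, F i) / 2)
      (y := (∑ i ∈ T, Real.log (1 + lam * F i)) / 2) (by positivity) (by positivity)
    have h' : |a * (∑ i ∈ T, F i) / 2 - (∑ i ∈ T, Real.log (1 + lam * F i)) / 2| ≤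
        T.card * lam ^ 2 := by
      have e : a * (∑ i ∈ T, F i) / 2 - (∑ i ∈ T, Real.log (1 + lam * F i)) / 2 =
          (∑ i ∈ T, (a * F i - Real.log (1 + lam * F i))) / 2 := by
        rw [Finset.sum_sub_distrib, Finset.mul_sum]; ring
      have hs : |∑ i ∈ T, (a * F i - Real.log (1 + lam * F i))| ≤ T.card * lam ^ 2 := by
        refine (Finset.abs_sum_le_sum_abs _ _).trans ?_
        rw [← nsmul_eq_mul]
        exact Finset.sum_le_card_nsmul _ _ _ fun i _ => abs_mul_log_sub_log_le hl (hF0 i) (hF1 i)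
      rw [e, abs_div, abs_of_pos (show (0 : ℝ) < 2 by norm_num)]
      have : (0 : ℝ) ≤ T.card * lam ^ 2 := by positivity
      linarith
    refine sq_le_sq.2 ((h.trans h').trans (le_abs_self _))
  calc (p - t) ^ 2 = ((q - r) + (p - q) + (r - t)) ^ 2 := by ring
    _ ≤ (1 + η) * (q - r) ^ 2 + (1 + 1 / η) * (2 * ((p - q) ^ 2 + (r - t) ^ 2)) :=
        add_sq_le hη _ _ _
    _ ≤ _ := by gcongr

end Contraction

end HardCore

namespace HardCore

section Messages

variable {V : Type} [Fintype V] [DecidableEq V] {G : SimpleGraph V} [DecidableRel G.Adj]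
  {lam : ℝ}

lemma bpIter_mem_Icc (hl : 0 < lam) {R : V → V → ℝ} (hR : ∀ a b, R a b ∈ Set.Icc (0 : ℝ) lam)
    (v p : V) : bpIter G lam R v p ∈ Set.Icc (0 : ℝ) lam := by
  have h0 : ∀ w, 0 ≤ (1 + R w v)⁻¹ := fun w => inv_nonneg.2 (by linarith [(hR w v).1])
  refine ⟨mul_nonneg hl.le (Finset.prod_nonneg fun w _ => h0 w), ?_⟩
  refine mul_le_of_le_one_right hl.le (Finset.prod_le_one (fun w _ => h0 w) fun w _ => ?_)
  exact inv_le_one_of_one_le₀ (by linarith [(hR w v).1])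

lemma iterate_bpIter_mem_Icc (hl : 0 < lam) {R : V → V → ℝ}
    (hR : ∀ a b, R a b ∈ Set.Icc (0 : ℝ) lam) (t : ℕ) (a b : V) :
    ((bpIter G lam)^[t] R) a b ∈ Set.Icc (0 : ℝ) lam := by
  induction t generalizing a b with
  | zero => exact hR a b
  | succ t ih => rw [Function.iterate_succ_apply']; exact bpIter_mem_Icc hl ih a b

lemma div_mem_unit {x : ℝ} (hl : 0 < lam) (hx : x ∈ Set.Icc (0 : ℝ) lam) :
    0 ≤ x / lam ∧ x / lam ≤ 1 :=
  ⟨div_nonneg hx.1 hl.le, (div_le_one hl).2 hx.2⟩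

lemma bpIter_div (hl : 0 < lam) (R : V → V → ℝ) (v p : V) :
    bpIter G lam R v p / lam =
      ∏ w ∈ (G.neighborFinset v).erase p, (1 + lam * (R w v / lam))⁻¹ := by
  rw [bpIter, mul_div_cancel_left₀ _ hl.ne']
  exact Finset.prod_congr rfl fun w _ => by rw [mul_div_cancel₀ _ hl.ne']

lemma card_erase_neighborFinset_le (v p : V) :
    (((G.neighborFinset v).erase p).card : ℝ) ≤ G.maxDegree := by
  have h1 := Finset.card_le_card (Finset.erase_subset p (G.neighborFinset v))
  rw [G.card_neighborFinset_eq_degree] at h1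
  exact_mod_cast h1.trans (G.degree_le_maxDegree v)

lemma exp_neg_le_bpIter_div (hl : 0 < lam) {R : V → V → ℝ}
    (hR : ∀ a b, R a b ∈ Set.Icc (0 : ℝ) lam) (v p : V) :
    Real.exp (-(lam * G.maxDegree)) ≤ bpIter G lam R v p / lam := by
  rw [bpIter, mul_div_cancel_left₀ _ hl.ne']
  set T := (G.neighborFinset v).erase p
  calc Real.exp (-(lam * G.maxDegree)) ≤ Real.exp (-(lam * T.card)) := by
        have := card_erase_neighborFinset_le (G := G) v p
        gcongr
    _ = ∏ w ∈ T, Real.exp (-lam) := by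
        rw [Finset.prod_const, ← Real.exp_nat_mul]; congr 1; ring
    _ ≤ _ := by
        refine Finset.prod_le_prod (fun _ _ => (Real.exp_pos _).le) fun w _ => ?_
        rw [Real.exp_neg]
        have h1 := (hR w v).1
        have h2 := (hR w v).2
        refine inv_anti₀ (by linarith) ?_
        linarith [Real.add_one_le_exp lam]

/-- The mean square distance between a belief propagation message and the corresponding
conditional vacancy probability, measured in the square root coordinate. -/
def messageError (G : SimpleGraph V) [DecidableRel G.Adj] (lam : ℝ) (R : V → V → ℝ) (v p : V) :
    ℝ :=
  gibbsExp G lam (fun s => (√(vacantProb G lam v p s) - √(R v p / lam)) ^ 2)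

lemma messageError_bpIter_le (hG : 6 ≤ G.egirth) (hl : 0 < lam) {η M : ℝ} (hη : 0 < η)
    {R : V → V → ℝ} (hR : ∀ a b, R a b ∈ Set.Icc (0 : ℝ) lam)
    (hM0 : 0 ≤ M) (hM : ∀ v p, G.Adj v p → messageError G lam R v p ≤ M) (v p : V) :
    messageError G lam (bpIter G lam R) v p ≤
      (1 + η) * (lam * Real.exp (-1) * (G.maxDegree * M)) +
      (1 + 1 / η) * (2 * (lam ^ 2 * (G.maxDegree + (G.maxDegree : ℝ) ^ 2 * lam) +
        (G.maxDegree * lam ^ 2) ^ 2)) := by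
  set T := (G.neighborFinset v).erase p with hT
  have hcard := card_erase_neighborFinset_le (G := G) v p
  rw [← hT] at hcard
  have hpt : ∀ s, (√(vacantProb G lam v p s) - √(bpIter G lam R v p / lam)) ^ 2 ≤
      (1 + η) * (lam * Real.exp (-1) *
        ∑ w ∈ T, (√(vacantProb G lam w v s) - √(R w v / lam)) ^ 2) +
      ((1 + 1 / η) * (2 * lam ^ 2) * (∑ w ∈ T, vacantDev G lam w v s) ^ 2 +
        (1 + 1 / η) * (2 * (T.card * lam ^ 2) ^ 2)) := by
    intro s
    rw [bpIter_div hl]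
    refine (sq_sqrt_exp_sub_sqrt_prod_le hl hη T
      (fun w => vacant ((G.neighborFinset w).erase v) s) (fun w => vacantProb G lam w v s)
      (fun w => R w v / lam) (fun w => vacant_nonneg _ _) (fun w => (vacantProb_pos w v s).le)
      (fun w => (div_mem_unit hl (hR w v)).1) (fun w => (div_mem_unit hl (hR w v)).2)).trans ?_
    apply le_of_eq
    simp only [vacantDev]
    ring
  have hdev := gibbsExp_sq_sum_vacantDev_le hG hl v p
  rw [← hT] at hdev
  have hdeg : (G.degree v : ℝ) ≤ G.maxDegree := by exact_mod_cast G.degree_le_maxDegree v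
  have hsum : ∑ w ∈ T, messageError G lam R w v ≤ G.maxDegree * M := by
    calc _ ≤ ∑ w ∈ T, M := Finset.sum_le_sum fun w hw =>
          hM w v ((G.mem_neighborFinset _ _).1 (Finset.mem_of_mem_erase hw)).symm
      _ = T.card * M := by rw [Finset.sum_const, nsmul_eq_mul]
      _ ≤ _ := by gcongr
  refine (gibbsExp_mono hl hpt).trans ?_
  rw [gibbsExp_add, gibbsExp_add, gibbsExp_const hl, gibbsExp_const_mul, gibbsExp_const_mul,
    gibbsExp_const_mul, gibbsExp_sum]
  have h2 : gibbsExp G lam (fun s => (∑ w ∈ T, vacantDev G lam w v s) ^ 2) ≤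
      G.maxDegree + (G.maxDegree : ℝ) ^ 2 * lam := hdev.trans (by gcongr)
  calc _ ≤ (1 + η) * (lam * Real.exp (-1) * (G.maxDegree * M)) +
        ((1 + 1 / η) * (2 * lam ^ 2) * (G.maxDegree + (G.maxDegree : ℝ) ^ 2 * lam) +
          (1 + 1 / η) * (2 * (G.maxDegree * lam ^ 2) ^ 2)) := by
        gcongr
        exact hsum
    _ = _ := by ring

lemma messageError_le_one (hl : 0 < lam) {R : V → V → ℝ}
    (hR : ∀ a b, R a b ∈ Set.Icc (0 : ℝ) lam) (v p : V) : messageError G lam R v p ≤ 1 := by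
  rw [← gibbsExp_const (G := G) hl 1]
  refine gibbsExp_mono hl fun s => ?_
  have h1 := Real.sqrt_nonneg (vacantProb G lam v p s)
  have h2 := Real.sqrt_nonneg (R v p / lam)
  have h3 : √(vacantProb G lam v p s) ≤ 1 := Real.sqrt_le_one.2 (vacantProb_le_one hl v p s)
  have h4 : √(R v p / lam) ≤ 1 := Real.sqrt_le_one.2 (div_mem_unit hl (hR v p)).2
  rw [sq_le_one_iff_abs_le_one, abs_le]
  constructor <;> linarith

lemma messageError_iterate_le (hG : 6 ≤ G.egirth) (hl : 0 < lam) {δ K : ℝ} (hδ0 : 0 < δ)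
    (hδ1 : δ < 1) (hD : 1 ≤ (G.maxDegree : ℝ)) (hlD3 : lam * G.maxDegree ≤ 3)
    (hlD : lam * G.maxDegree ≤ (1 - δ / 2) * Real.exp 1)
    (hK : (1 + 4 / δ) * (4 / δ) * (234 / G.maxDegree) ≤ K)
    {R : V → V → ℝ} (hR : ∀ a b, R a b ∈ Set.Icc (0 : ℝ) lam) (t : ℕ) :
    ∀ v p, G.Adj v p → messageError G lam ((bpIter G lam)^[t] R) v p ≤ (1 - δ / 4) ^ t + K := by
  set D : ℝ := (G.maxDegree : ℝ) with hDdef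
  have hD0 : 0 < D := by linarith
  have hK0 : 0 ≤ K := le_trans (by positivity) hK
  induction t with
  | zero =>
    intro v p _
    have := messageError_le_one (G := G) hl hR v p
    simp only [Function.iterate_zero, id, pow_zero]
    linarith
  | succ t ih =>
    intro v p _
    rw [Function.iterate_succ_apply']
    have hρ : 0 ≤ (1 - δ / 4) ^ t := pow_nonneg (by linarith) _
    refine (messageError_bpIter_le hG hl (show 0 < δ / 4 by positivity)
      (iterate_bpIter_mem_Icc hl hR t) (add_nonneg hρ hK0) ih v p).trans ?_
    rw [← hDdef]
    set M := (1 - δ / 4) ^ t + K with hM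
    have hM0 : 0 ≤ M := add_nonneg hρ hK0
    have hx : 0 ≤ lam * D := by positivity
    have h1 : (1 + δ / 4) * (lam * Real.exp (-1) * (D * M)) ≤ (1 - δ / 4) * M := by
      have e1 : lam * D * Real.exp (-1) ≤ 1 - δ / 2 := by
        calc _ ≤ (1 - δ / 2) * Real.exp 1 * Real.exp (-1) := by gcongr
          _ = 1 - δ / 2 := by rw [mul_assoc, ← Real.exp_add]; simp
      have e2 : (1 + δ / 4) * (lam * D * Real.exp (-1)) ≤ 1 - δ / 4 := by
        calc _ ≤ (1 + δ / 4) * (1 - δ / 2) := by gcongr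
          _ ≤ _ := by nlinarith
      calc _ = ((1 + δ / 4) * (lam * D * Real.exp (-1))) * M := by ring
        _ ≤ _ := by gcongr
    have h2 : 2 * (lam ^ 2 * (D + D ^ 2 * lam) + (D * lam ^ 2) ^ 2) ≤ 234 / D := by
      have e : 2 * (lam ^ 2 * (D + D ^ 2 * lam) + (D * lam ^ 2) ^ 2) =
          2 * ((lam * D) ^ 2 + (lam * D) ^ 3 + (lam * D) ^ 4 / D) / D := by
        field_simp
      have e4 : (lam * D) ^ 4 / D ≤ (lam * D) ^ 4 := div_le_self (by positivity) hD
      rw [e]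
      gcongr
      have p2 : (lam * D) ^ 2 ≤ 3 ^ 2 := by gcongr
      have p3 : (lam * D) ^ 3 ≤ 3 ^ 3 := by gcongr
      have p4 : (lam * D) ^ 4 ≤ 3 ^ 4 := by gcongr
      linarith
    have h3 : (1 + 1 / (δ / 4)) * (234 / D) ≤ δ / 4 * K := by
      calc (1 + 1 / (δ / 4)) * (234 / D) = δ / 4 * ((1 + 4 / δ) * (4 / δ) * (234 / D)) := by
            field_simp
        _ ≤ _ := by gcongr
    calc _ ≤ (1 - δ / 4) * M + (1 + 1 / (δ / 4)) * (234 / D) := by gcongr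
      _ ≤ (1 - δ / 4) * M + δ / 4 * K := by gcongr
      _ = _ := by rw [hM, pow_succ]; ring

lemma abs_gibbsExp_vacantProb_sub_le (hl : 0 < lam) {R : V → V → ℝ}
    (hR : ∀ a b, R a b ∈ Set.Icc (0 : ℝ) lam) {c : ℝ} (hc : 0 < c) {v p : V}
    (h : messageError G lam R v p ≤ c ^ 2) :
    |gibbsExp G lam (vacantProb G lam v p) - R v p / lam| ≤ 4 * c := by
  obtain ⟨hF0, hF1⟩ := div_mem_unit hl (hR v p)
  set F := R v p / lam
  have h1 : gibbsExp G lam (vacantProb G lam v p) - F =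
      gibbsExp G lam (fun s => vacantProb G lam v p s - F) := by
    rw [gibbsExp_sub, gibbsExp_const hl]
  rw [h1]
  have hpt : ∀ s, |vacantProb G lam v p s - F| ≤
      2 * c + 2 / c * (√(vacantProb G lam v p s) - √F) ^ 2 := by
    intro s
    have hy := (vacantProb_pos (G := G) (lam := lam) v p s).le
    set y := vacantProb G lam v p s
    have hy1 : √y ≤ 1 := Real.sqrt_le_one.2 (vacantProb_le_one hl v p s)
    have hF1' : √F ≤ 1 := Real.sqrt_le_one.2 hF1
    have e : y - F = (√y - √F) * (√y + √F) := by
      have e1 := Real.mul_self_sqrt hy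
      have e2 := Real.mul_self_sqrt hF0
      linear_combination -e1 + e2
    have hs : |√y + √F| ≤ 2 := by
      rw [abs_of_nonneg (by positivity)]; linarith
    have hq : |√y - √F| ≤ c + (√y - √F) ^ 2 / c := by
      set u := √y - √F
      rw [← sq_abs u]
      have : 0 ≤ (|u| - c) ^ 2 / c := by positivity
      have e' : (|u| - c) ^ 2 / c = |u| ^ 2 / c - 2 * |u| + c := by field_simp; ring
      rw [e'] at this
      linarith [abs_nonneg u]
    rw [e, abs_mul]
    calc _ ≤ (c + (√y - √F) ^ 2 / c) * 2 := by gcongr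
      _ = _ := by ring
  refine (abs_gibbsExp_le hl hpt).trans ?_
  rw [gibbsExp_add, gibbsExp_const hl, gibbsExp_const_mul]
  calc _ ≤ 2 * c + 2 / c * c ^ 2 := by gcongr; exact h
    _ = 4 * c := by field_simp; ring

lemma condOcc_eq (hl : 0 < lam) {v p : V} (hvp : G.Adj v p) :
    condOcc G lam v p = (lam / (1 + lam) * gibbsExp G lam (vacant (G.neighborFinset v))) /
      (1 - gibbsExp G lam (fun s => 1 - vacant {p} s)) := by
  have hnum : (∑ s : Finset V, if IsIndep G s ∧ v ∈ s ∧ p ∉ s then lam ^ s.card else 0) =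
      ∑ s, weight G lam s * (1 - vacant {v} s) := by
    refine Finset.sum_congr rfl fun s _ => ?_
    by_cases hi : IsIndep G s
    · by_cases hv : v ∈ s
      · have hp : p ∉ s := fun hp => hi v hv p hp hvp
        simp [weight, vacant, hi, hv, hp]
      · simp [weight, vacant, hv]
    · simp [weight, hi]
  have hden : (∑ s : Finset V, if IsIndep G s ∧ p ∉ s then lam ^ s.card else 0) =
      ∑ s, weight G lam s * vacant {p} s := by
    refine Finset.sum_congr rfl fun s _ => ?_
    by_cases hi : IsIndep G s <;> by_cases hp : p ∈ s <;> simp [weight, vacant, hi, hp]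
  have h1 : 1 - gibbsExp G lam (fun s => 1 - vacant {p} s) = gibbsExp G lam (vacant {p}) := by
    rw [gibbsExp_sub, gibbsExp_const hl]; ring
  rw [h1, ← gibbsExp_occupied hl, condOcc, hnum, hden, gibbsExp, gibbsExp,
    div_div_div_cancel_right₀ (partitionFn_pos hl).ne']

lemma abs_gibbsExp_vacant_sub_vacantProb_le (hG : 6 ≤ G.egirth) (hl : 0 < lam) (v p : V) :
    |gibbsExp G lam (vacant (G.neighborFinset v)) - gibbsExp G lam (vacantProb G lam v p)| ≤
      2 * lam := by
  have h1 : |gibbsExp G lam (vacant ((G.neighborFinset v).erase p)) -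
      gibbsExp G lam (vacantProb G lam v p)| ≤ lam := by
    rw [← gibbsExp_sub]
    have := abs_gibbsExp_vacantDev_mul_le hG hl v p (f := fun _ => 1) (by simp) (fun _ => rfl)
    simpa only [vacantDev, mul_one] using this
  have h2 : |gibbsExp G lam (vacant (G.neighborFinset v)) -
      gibbsExp G lam (vacant ((G.neighborFinset v).erase p))| ≤ lam := by
    rw [← gibbsExp_sub]
    refine (abs_gibbsExp_le hl fun s => ?_).trans (gibbsExp_occupied_le (G := G) hl p)
    by_cases hp : p ∈ s
    · have a1 := vacant_nonneg (G.neighborFinset v) s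
      have a2 := vacant_le_one (G.neighborFinset v) s
      have a3 := vacant_nonneg ((G.neighborFinset v).erase p) s
      have a4 := vacant_le_one ((G.neighborFinset v).erase p) s
      have a5 : vacant {p} s = 0 := by simp [vacant, hp]
      rw [a5, abs_le]
      constructor <;> linarith
    · have : Disjoint (G.neighborFinset v) s ↔ Disjoint ((G.neighborFinset v).erase p) s := by
        refine ⟨fun h => h.mono_left (Finset.erase_subset _ _), fun h => ?_⟩
        rw [Finset.disjoint_left] at *
        intro x hx hxs
        exact h (Finset.mem_erase.2 ⟨fun e => hp (e ▸ hxs), hx⟩) hxs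
      simp [vacant, this, hp]
  calc _ = |(gibbsExp G lam (vacant (G.neighborFinset v)) -
        gibbsExp G lam (vacant ((G.neighborFinset v).erase p))) +
        (gibbsExp G lam (vacant ((G.neighborFinset v).erase p)) -
          gibbsExp G lam (vacantProb G lam v p))| := by congr 1; ring
    _ ≤ _ := (abs_add_le _ _).trans (by linarith)

end Messages

section Numerics

/-- Comparing a message `λF / (1 + λF)` with a marginal `λ/(1+λ) · P / (1 - o)`. -/
lemma abs_ratio_sub_one_le {lam F P o b c m : ℝ} (hl : 0 < lam) (hlc : lam ≤ c)
    (hb : 0 < b) (hm0 : 0 < m) (hm1 : m ≤ 1) (hb1 : b ≤ 1) (hc : c = m * b / 32) (hbF : b ≤ F)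
    (hF1 : F ≤ 1) (hP1 : P ≤ 1) (ho0 : 0 ≤ o) (hol : o ≤ lam)
    (hPF : |P - F| ≤ 2 * lam + 4 * c) :
    |(lam * F / (1 + lam * F)) / (lam / (1 + lam) * P / (1 - o)) - 1| ≤ m := by
  have hc0 : 0 < c := by rw [hc]; positivity
  have hcb : c ≤ b / 32 := by rw [hc]; nlinarith
  have hF0 : 0 < F := by linarith
  obtain ⟨h1, h2⟩ := abs_le.1 hPF
  have hP : b / 2 ≤ P := by linarith
  have hP0 : 0 < P := by linarith
  have ho1 : 0 < 1 - o := by linarith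
  have hlF : 0 < 1 + lam * F := by positivity
  have e : (lam * F / (1 + lam * F)) / (lam / (1 + lam) * P / (1 - o)) - 1 =
      (F * (1 + lam) * (1 - o) - (1 + lam * F) * P) / ((1 + lam * F) * P) := by
    field_simp
  have hden : b / 2 ≤ (1 + lam * F) * P := by
    have : 0 ≤ lam * F * P := by positivity
    linarith
  rw [e, abs_div, abs_of_pos (show 0 < (1 + lam * F) * P by positivity),
    div_le_iff₀ (by positivity)]
  have hlF1 : lam * F ≤ lam := mul_le_of_le_one_right hl.le hF1
  have hlF0 : 0 ≤ lam * F := by positivity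
  have hnum : |F * (1 + lam) * (1 - o) - (1 + lam * F) * P| ≤ 10 * c := by
    have q1 : 0 ≤ F * o := by positivity
    have q2 : F * o ≤ lam := (mul_le_of_le_one_left ho0 hF1).trans hol
    have q3 : 0 ≤ lam * F * o := by positivity
    have q4 : lam * F * o ≤ lam :=
      (mul_le_of_le_one_right hlF0 (by linarith)).trans hlF1
    have q5 : 0 ≤ lam * F * P := by positivity
    have q6 : lam * F * P ≤ lam := (mul_le_of_le_one_right hlF0 hP1).trans hlF1
    have e2 : F * (1 + lam) * (1 - o) - (1 + lam * F) * P =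
        (F - P) + lam * F - F * o - lam * F * o - lam * F * P := by ring
    rw [e2, abs_le]
    constructor <;> linarith
  calc _ ≤ 10 * c := hnum
    _ ≤ m * (b / 2) := by rw [hc]; nlinarith [mul_pos hm0 hb]
    _ ≤ _ := by gcongr

lemma lambdaC_pos {D : ℕ} (hD : 3 ≤ D) : 0 < lambdaC D := by
  have : (3 : ℝ) ≤ D := by exact_mod_cast hD
  unfold lambdaC
  have h1 : (0 : ℝ) < (D : ℝ) - 1 := by linarith
  have h2 : (0 : ℝ) < (D : ℝ) - 2 := by linarith
  positivity

lemma lambdaC_mul_le {D : ℕ} (hD : 3 ≤ D) {δ : ℝ} (hδ0 : 0 < δ)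
    (hDδ : 10 / δ + 2 ≤ (D : ℝ)) : lambdaC D * D ≤ (1 + δ / 2) * Real.exp 1 := by
  obtain ⟨n, rfl⟩ : ∃ n, D = n + 2 := ⟨D - 2, by omega⟩
  have hn : 1 ≤ (n : ℝ) := by exact_mod_cast (by omega : 1 ≤ n)
  have hn0 : (0 : ℝ) < n := by linarith
  push_cast at hDδ
  have hnδ : 10 / δ ≤ n := by linarith
  have h5 : 5 / (n : ℝ) ≤ δ / 2 := by
    rw [div_le_iff₀ hδ0] at hnδ
    rw [div_le_iff₀ hn0]
    nlinarith
  have e : lambdaC (n + 2) * ((n + 2 : ℕ) : ℝ) =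
      (1 + 1 / (n : ℝ)) ^ n * ((1 + 1 / n) * (1 + 2 / n)) := by
    unfold lambdaC
    push_cast
    have e1 : (n : ℝ) + 2 - 1 = n + 1 := by ring
    have e2 : (n : ℝ) + 2 - 2 = n := by ring
    have e3 : 1 + 1 / (n : ℝ) = (n + 1) / n := by field_simp
    rw [e1, e2, e3, div_pow, pow_succ, pow_add]
    field_simp
  rw [e, mul_comm]
  have hexp : (1 + 1 / (n : ℝ)) ^ n ≤ Real.exp 1 := by
    calc (1 + 1 / (n : ℝ)) ^ n ≤ (Real.exp (1 / n)) ^ n := by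
          gcongr
          linarith [Real.add_one_le_exp (1 / (n : ℝ))]
      _ = Real.exp 1 := by rw [← Real.exp_nat_mul]; congr 1; field_simp
  have hpoly : (1 + 1 / (n : ℝ)) * (1 + 2 / n) ≤ 1 + δ / 2 := by
    have : (1 + 1 / (n : ℝ)) * (1 + 2 / n) ≤ 1 + 5 / n := by
      have h1 : 1 / (n : ℝ) ≤ 1 := by rw [div_le_one hn0]; exact hn
      have h0 : 0 < 1 / (n : ℝ) := by positivity
      have e2 : 2 / (n : ℝ) = 2 * (1 / n) := by ring
      have e5 : 5 / (n : ℝ) = 5 * (1 / n) := by ring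
      rw [e2, e5]
      nlinarith
    linarith
  gcongr

end Numerics

end HardCore

open HardCore

theorem loopyBP_converges_to_gibbs_marginal :
    ∀ δ ε : ℝ, 0 < δ → 0 < ε →
    ∃ (Δ₀ : ℕ) (C : ℝ), 0 < C ∧
      ∀ (V : Type) [Fintype V] [DecidableEq V] (G : SimpleGraph V) [DecidableRel G.Adj]
        (Δ : ℕ) (lam : ℝ),
        G.maxDegree = Δ → Δ₀ ≤ Δ → 6 ≤ G.egirth →
        0 < lam → lam < (1 - δ) * lambdaC Δ →
        ∀ R0 : V → V → ℝ, (∀ a b : V, R0 a b ∈ Set.Icc (0 : ℝ) lam) →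
        ∀ t : ℕ, C ≤ (t : ℝ) →
        ∀ v p : V, G.Adj v p →
          |(((bpIter G lam)^[t] R0) v p / (1 + ((bpIter G lam)^[t] R0) v p)) /
              condOcc G lam v p - 1| ≤ ε := by
  intro δ ε hδ0 hε
  rcases le_or_gt 1 δ with hδ1 | hδ1
  · refine ⟨3, 1, one_pos, ?_⟩
    intro V _ _ G _ Δ lam _ hΔ _ hl hlc
    have := lambdaC_pos hΔ
    nlinarith
  set m := min ε 1 with hm
  have hm0 : 0 < m := lt_min hε one_pos
  set b := Real.exp (-3) with hb
  have hb0 : 0 < b := Real.exp_pos _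
  have hb1 : b ≤ 1 := Real.exp_le_one_iff.2 (by norm_num)
  set c := m * b / 32 with hc
  have hc0 : 0 < c := by positivity
  obtain ⟨N, hN⟩ := exists_pow_lt_of_lt_one (show 0 < c ^ 2 / 2 by positivity)
    (show 1 - δ / 4 < 1 by linarith)
  obtain ⟨Δ₀, hΔ₀⟩ := exists_nat_ge (3 + (10 / δ + 2) + 3 / c +
    (1 + 4 / δ) * (4 / δ) * 234 / (c ^ 2 / 2))
  refine ⟨Δ₀, N + 1, by positivity, ?_⟩
  intro V _ _ G _ Δ lam hmax hΔ hG hl hlc R0 hR0 t ht v p hvp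
  have hΔ' : (Δ₀ : ℝ) ≤ Δ := by exact_mod_cast hΔ
  have hp1 : 0 < 10 / δ + 2 := by positivity
  have hp2 : 0 < 3 / c := by positivity
  have hp3 : 0 < (1 + 4 / δ) * (4 / δ) * 234 / (c ^ 2 / 2) := by positivity
  have hΔ3 : (3 : ℝ) ≤ Δ := by linarith
  have hΔpos : (0 : ℝ) < Δ := by linarith
  have hΔ3' : 3 ≤ Δ := by exact_mod_cast hΔ3
  have hlD : lam * Δ ≤ (1 - δ / 2) * Real.exp 1 := by
    have h1 := lambdaC_mul_le hΔ3' hδ0 (by linarith)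
    calc lam * Δ ≤ (1 - δ) * lambdaC Δ * Δ := by gcongr
      _ = (1 - δ) * (lambdaC Δ * Δ) := by ring
      _ ≤ (1 - δ) * ((1 + δ / 2) * Real.exp 1) := by
          have : 0 < 1 - δ := by linarith
          gcongr
      _ = ((1 - δ) * (1 + δ / 2)) * Real.exp 1 := by ring
      _ ≤ _ := by gcongr; nlinarith
  have hlD3 : lam * Δ ≤ 3 := by
    have h1 := Real.exp_one_lt_d9
    have h2 := Real.exp_pos 1
    nlinarith
  have hlc' : lam ≤ c := by
    have h1 : 3 / c ≤ Δ := by linarith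
    rw [div_le_iff₀ hc0] at h1
    nlinarith
  have hK : (1 + 4 / δ) * (4 / δ) * (234 / (Δ : ℝ)) ≤ c ^ 2 / 2 := by
    have h1 : (1 + 4 / δ) * (4 / δ) * 234 / (c ^ 2 / 2) ≤ Δ := by linarith
    rw [div_le_iff₀ (by positivity)] at h1
    rw [mul_div_assoc', div_le_iff₀ hΔpos]
    linarith
  have htN : N + 1 ≤ t := by exact_mod_cast ht
  obtain ⟨k, rfl⟩ : ∃ k, t = k + 1 := ⟨t - 1, by omega⟩
  set R := (bpIter G lam)^[k + 1] R0 with hR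
  have hRmem : ∀ a b, R a b ∈ Set.Icc (0 : ℝ) lam := iterate_bpIter_mem_Icc hl hR0 (k + 1)
  have herr : messageError G lam R v p ≤ c ^ 2 := by
    have h1 := messageError_iterate_le hG hl hδ0 hδ1 (K := c ^ 2 / 2)
      (by rw [hmax]; linarith) (by rwa [hmax]) (by rwa [hmax]) (by rwa [hmax]) hR0 (k + 1) v p hvp
    have h2 : (1 - δ / 4) ^ (k + 1) ≤ (1 - δ / 4) ^ N :=
      pow_le_pow_of_le_one (by linarith) (by linarith) (by omega)
    linarith
  have hF := abs_gibbsExp_vacantProb_sub_le hl hRmem hc0 herr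
  have hP := abs_gibbsExp_vacant_sub_vacantProb_le (G := G) hG hl v p
  have hbF : b ≤ R v p / lam := by
    have h1 := exp_neg_le_bpIter_div (G := G) hl (iterate_bpIter_mem_Icc (G := G) hl hR0 k) v p
    rw [← Function.iterate_succ_apply' (bpIter G lam) k R0, hmax] at h1
    exact (Real.exp_le_exp.2 (by linarith)).trans h1
  have hP1 : gibbsExp G lam (vacant (G.neighborFinset v)) ≤ 1 := by
    have := gibbsExp_mono (G := G) hl (vacant_le_one (G.neighborFinset v))
    rwa [gibbsExp_const hl] at this
  have hfin := abs_ratio_sub_one_le (F := R v p / lam)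
    (P := gibbsExp G lam (vacant (G.neighborFinset v)))
    (o := gibbsExp G lam (fun s => 1 - vacant {p} s)) hl hlc' hb0 hm0 (min_le_right _ _) hb1 hc
    hbF (div_mem_unit hl (hRmem v p)).2 hP1 (gibbsExp_occupied_nonneg hl p)
    (gibbsExp_occupied_le hl p)
    (by
      obtain ⟨a1, a2⟩ := abs_le.1 hF
      obtain ⟨a3, a4⟩ := abs_le.1 hP
      rw [abs_le]; constructor <;> linarith)
  rw [mul_div_cancel₀ _ hl.ne'] at hfin
  rw [condOcc_eq hl hvp]
  exact hfin.trans (min_le_left _ _)
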